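/- arXiv:2004.03656 — 5 statements merged into one kernel-verified Lean document; each statement's English description precedes it below -/
import Mathlib

section
/- Let C be a type, let Γ be a subgroup of the permutation group of C, and let Z : Γ → Γ be a bijection. Suppose T' : C → C is gauge-invariant with respect to Γ and Z, i.e. for every γ ∈ Γ one has (Z γ) ∘ T' = T' ∘ γ as functions on C. If T : C → C is simulated by T', i.e. for every c ∈ C there exist γ, γ' ∈ Γ with γ (T c) = T' (γ' c), then for every c ∈ C there exists γ ∈ Γ such that T c = T' (γ c). -/
theorem stmt_0 {C : Type*} (Γ : Subgroup (Equiv.Perm C)) (Z : Γ → Γ)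
    (hZ : Function.Bijective Z) (T T' : C → C)
    (hinv : ∀ γ : Γ, ⇑(Z γ : Equiv.Perm C) ∘ T' = T' ∘ ⇑(γ : Equiv.Perm C))
    (hsim : ∀ c : C, ∃ γ γ' : Γ,
      (γ : Equiv.Perm C) (T c) = T' ((γ' : Equiv.Perm C) c)) :
    ∀ c : C, ∃ γ : Γ, T c = T' ((γ : Equiv.Perm C) c) := by
  intro c
  obtain ⟨γ, γ', h⟩ := hsim c
  obtain ⟨δ, hδ⟩ := hZ.surjective γ⁻¹
  refine ⟨δ * γ', ?_⟩
  have hcomm := congrFun (hinv δ) ((γ' : Equiv.Perm C) c)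
  rw [hδ] at hcomm
  simpa [← h] using hcomm
end

section
/- Let C be a type, let Γ be a subgroup of the permutation group of C, let Z : Γ → Γ be a bijection, and let T, T' : C → C both be gauge-invariant with respect to Γ and Z (i.e. (Z γ) ∘ T = T ∘ γ and (Z γ) ∘ T' = T' ∘ γ for all γ ∈ Γ). Then the following three statements are equivalent: (1) for every c ∈ C there exist γ, γ' ∈ Γ with γ (T c) = T' (γ' c); (2) for every c ∈ C there exists γ ∈ Γ with T c = T' (γ c); (3) for every c ∈ C and every γ ∈ Γ there exists γ' ∈ Γ with γ (T c) = T' (γ' c). -/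
/-- If `F` is gauge-invariant for a surjective `Z`, every gauge transformation of a value of `F`
can be absorbed into its argument. -/
theorem exists_apply_eq_of_gaugeInvariant {C : Type*} {Γ : Subgroup (Equiv.Perm C)} {Z : Γ → Γ}
    (hZ : Function.Surjective Z) {F : C → C}
    (hF : ∀ γ : Γ, ⇑(Z γ : Equiv.Perm C) ∘ F = F ∘ ⇑(γ : Equiv.Perm C)) (γ γ' : Γ) (c : C) :
    ∃ δ : Γ, (γ : Equiv.Perm C) (F ((γ' : Equiv.Perm C) c)) = F ((δ : Equiv.Perm C) c) := by
  obtain ⟨δ, rfl⟩ := hZ γ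
  exact ⟨δ * γ', congrFun (hF δ) _⟩

theorem stmt_2 {C : Type*} (Γ : Subgroup (Equiv.Perm C)) (Z : Γ → Γ)
    (hZ : Function.Bijective Z) (T T' : C → C)
    (hinvT : ∀ γ : Γ, ⇑(Z γ : Equiv.Perm C) ∘ T = T ∘ ⇑(γ : Equiv.Perm C))
    (hinvT' : ∀ γ : Γ, ⇑(Z γ : Equiv.Perm C) ∘ T' = T' ∘ ⇑(γ : Equiv.Perm C)) :
    ((∀ c : C, ∃ γ γ' : Γ,
        (γ : Equiv.Perm C) (T c) = T' ((γ' : Equiv.Perm C) c)) ↔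
      (∀ c : C, ∃ γ : Γ, T c = T' ((γ : Equiv.Perm C) c))) ∧
    ((∀ c : C, ∃ γ : Γ, T c = T' ((γ : Equiv.Perm C) c)) ↔
      (∀ c : C, ∀ γ : Γ, ∃ γ' : Γ,
        (γ : Equiv.Perm C) (T c) = T' ((γ' : Equiv.Perm C) c))) := by
  refine ⟨⟨fun h c => ?_, fun h c => ?_⟩, ⟨fun h c γ => ?_, fun h c => ?_⟩⟩
  · obtain ⟨γ, γ', h⟩ := h c
    obtain ⟨δ, hδ⟩ := exists_apply_eq_of_gaugeInvariant hZ.surjective hinvT' γ⁻¹ γ' c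
    refine ⟨δ, ?_⟩
    rw [← hδ, ← h]
    simp
  · obtain ⟨γ, h⟩ := h c
    exact ⟨1, γ, h⟩
  · obtain ⟨γ', h⟩ := h c
    rw [h]
    exact exists_apply_eq_of_gaugeInvariant hZ.surjective hinvT' γ γ' c
  · exact h c 1
end

section
/- Let R : (ℤ → Bool × Bool) → (ℤ → Bool × Bool) be the transport cellular automaton R(c)(x) = ((c (x+1)).1, (c (x-1)).2), and for g : ℤ → Bool let γ_g : (ℤ → Bool × Bool) → (ℤ → Bool × Bool) be the gauge transformation γ_g(c)(x) = (g x ⊕ (c x).1, g x ⊕ (c x).2) (⊕ denoting xor). Then there exists g : ℤ → Bool such that for every h : ℤ → Bool, γ_h ∘ R ≠ R ∘ γ_g. In particular no map Z from gauge transformations to gauge transformations can make R gauge-invariant. -/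
/-- The transport cellular automaton. -/
def transportCA (c : ℤ → Bool × Bool) : ℤ → Bool × Bool :=
  fun x => ((c (x + 1)).1, (c (x - 1)).2)

/-- The gauge transformation induced by a family `g : ℤ → Bool`. -/
def gaugeTransf (g : ℤ → Bool) (c : ℤ → Bool × Bool) : ℤ → Bool × Bool :=
  fun x => (xor (g x) (c x).1, xor (g x) (c x).2)

theorem stmt_3 :
    ∃ g : ℤ → Bool, ∀ h : ℤ → Bool,
      gaugeTransf h ∘ transportCA ≠ transportCA ∘ gaugeTransf g := by
  refine ⟨fun x => decide (x = 1), fun h heq => ?_⟩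
  have key := congrFun (congrFun heq fun _ => (false, false)) 0
  simp [gaugeTransf, transportCA] at key
end

section
/- Fix real parameters θ and β, set s = Real.sin θ and c = Real.cos θ, and let V = (((Fin 2 × Fin 2) × ℤ) →₀ ℂ) with canonical basis vectors e((m,n), l). Define the linear map r : V →ₗ[ℂ] V on basis vectors by: r(e((0,0), l)) = exp(I·β·l²) • e((0,0), l); r(e((0,1), l)) = exp(I·β·l²) • ((-I·s) • e((0,1), l) + c • e((1,0), l+1)); r(e((1,0), l)) = exp(I·β·l²) • (c • e((0,1), l-1) + (-I·s) • e((1,0), l)); r(e((1,1), l)) = -exp(I·β·l²) • e((1,1), l). For φ, φ' : ℝ let D(φ,φ') : V →ₗ[ℂ] V be the diagonal map D(φ,φ')(e((m,n), l)) = exp(I·(((m : ℤ) - l)·φ + ((n : ℤ) + l)·φ')) • e((m,n), l). Then r commutes with D(φ,φ') for all φ, φ' : ℝ; that is, the gate of the quantum cellular automaton is gauge-invariant with Z the identity. -/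
open Complex

/-- Canonical basis vector of `((Fin 2 × Fin 2) × ℤ) →₀ ℂ`. -/
noncomputable def e (a : (Fin 2 × Fin 2) × ℤ) : ((Fin 2 × Fin 2) × ℤ) →₀ ℂ :=
  Finsupp.single a 1

theorem stmt_9 (θ β : ℝ)
    (s : ℝ) (c : ℝ) (hs : s = Real.sin θ) (hc : c = Real.cos θ)
    (r : (((Fin 2 × Fin 2) × ℤ) →₀ ℂ) →ₗ[ℂ] (((Fin 2 × Fin 2) × ℤ) →₀ ℂ))
    (hr00 : ∀ l : ℤ, r (e ((0, 0), l)) =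
      Complex.exp (Complex.I * (β : ℂ) * (l : ℂ) ^ 2) • e ((0, 0), l))
    (hr01 : ∀ l : ℤ, r (e ((0, 1), l)) =
      Complex.exp (Complex.I * (β : ℂ) * (l : ℂ) ^ 2) •
        ((-Complex.I * (s : ℂ)) • e ((0, 1), l) + (c : ℂ) • e ((1, 0), l + 1)))
    (hr10 : ∀ l : ℤ, r (e ((1, 0), l)) =
      Complex.exp (Complex.I * (β : ℂ) * (l : ℂ) ^ 2) •
        ((c : ℂ) • e ((0, 1), l - 1) + (-Complex.I * (s : ℂ)) • e ((1, 0), l)))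
    (hr11 : ∀ l : ℤ, r (e ((1, 1), l)) =
      -Complex.exp (Complex.I * (β : ℂ) * (l : ℂ) ^ 2) • e ((1, 1), l))
    (D : ℝ → ℝ → ((((Fin 2 × Fin 2) × ℤ) →₀ ℂ) →ₗ[ℂ] (((Fin 2 × Fin 2) × ℤ) →₀ ℂ)))
    (hD : ∀ (φ φ' : ℝ) (m n : Fin 2) (l : ℤ),
      D φ φ' (e ((m, n), l)) =
        Complex.exp (Complex.I *
            ((((m : ℤ) : ℂ) - (l : ℂ)) * (φ : ℂ) + (((n : ℤ) : ℂ) + (l : ℂ)) * (φ' : ℂ)))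
          • e ((m, n), l)) :
    ∀ φ φ' : ℝ, r ∘ₗ D φ φ' = D φ φ' ∘ₗ r := by
  intro φ φ'
  refine Finsupp.lhom_ext' fun ⟨⟨m, n⟩, l⟩ => LinearMap.ext_ring ?_
  change r (D φ φ' (e ((m, n), l))) = D φ φ' (r (e ((m, n), l)))
  fin_cases m <;> fin_cases n
  · simp [hD, hr00, smul_smul, mul_comm]
  · simp only [Fin.zero_eta, Fin.mk_one, Fin.isValue, hD, hr01, map_smul, map_add]
    simp only [smul_add, smul_smul]
    congr 2
    · ring
    · push_cast [Fin.val_zero, Fin.val_one]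
      ring_nf
  · simp only [Fin.zero_eta, Fin.mk_one, Fin.isValue, hD, hr10, map_smul, map_add]
    simp only [smul_add, smul_smul]
    congr 2
    · push_cast [Fin.val_zero, Fin.val_one]
      ring_nf
    · ring
  · simp [hD, hr11, smul_smul, mul_comm]
end

section
/- Fix real parameters θ and β, set s = Real.sin θ and c = Real.cos θ, and let V = (((Fin 2 × Fin 2) × ℤ) →₀ ℂ) with canonical basis vectors e((m,n), l). Define r : V →ₗ[ℂ] V on basis vectors by: r(e((0,0), l)) = exp(I·β·l²) • e((0,0), l); r(e((0,1), l)) = exp(I·β·l²) • ((-I·s) • e((0,1), l) + c • e((1,0), l+1)); r(e((1,0), l)) = exp(I·β·l²) • (c • e((0,1), l-1) + (-I·s) • e((1,0), l)); r(e((1,1), l)) = -exp(I·β·l²) • e((1,1), l). Then r is bijective and preserves the hermitian inner product: for all x, y ∈ V, ∑_a conj((r x) a) · (r y) a = ∑_a conj(x a) · y a (the sums over the finite supports). That is, the gate r is unitary. -/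
open Complex

/-- The hermitian inner product `∑ a, conj (x a) * y a` on finitely supported functions. -/
noncomputable def hermitianForm {α : Type*} : (α →₀ ℂ) →ₗ⋆[ℂ] (α →₀ ℂ) →ₗ[ℂ] ℂ :=
  LinearMap.mk₂'ₛₗ (starRingEnd ℂ) (RingHom.id ℂ)
    (fun x y => x.sum fun a v => (starRingEnd ℂ) v * y a)
    (fun x x' y => Finsupp.sum_add_index' (by simp) (by simp [add_mul]))
    (fun k x y => by
      rw [Finsupp.sum_smul_index (by simp)]
      simp [Finsupp.mul_sum, mul_assoc])
    (fun x y y' => by simp [mul_add, Finsupp.sum_add])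
    (fun k x y => by simp [Finsupp.mul_sum, mul_left_comm])

theorem hermitianForm_apply {α : Type*} (x y : α →₀ ℂ) :
    hermitianForm x y = x.sum fun a v => (starRingEnd ℂ) v * y a := rfl

theorem hermitianForm_e (a : (Fin 2 × Fin 2) × ℤ) (y : ((Fin 2 × Fin 2) × ℤ) →₀ ℂ) :
    hermitianForm (e a) y = y a := by
  simp [hermitianForm_apply, e]

theorem single_eq_smul_e (a : (Fin 2 × Fin 2) × ℤ) (v : ℂ) :
    Finsupp.single a v = v • e a := by
  simp [e]

/-- A linear map that preserves the inner products of basis vectors preserves all of them. -/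
theorem hermitianForm_map_map
    {r : (((Fin 2 × Fin 2) × ℤ) →₀ ℂ) →ₗ[ℂ] (((Fin 2 × Fin 2) × ℤ) →₀ ℂ)}
    (h : ∀ a b, hermitianForm (r (e a)) (r (e b)) = hermitianForm (e a) (e b))
    (x y : ((Fin 2 × Fin 2) × ℤ) →₀ ℂ) :
    hermitianForm (r x) (r y) = hermitianForm x y := by
  induction x using Finsupp.induction_linear with
  | zero => simp
  | add x x' hx hx' => simp [hx, hx']
  | single a v =>
    induction y using Finsupp.induction_linear with
    | zero => simp
    | add y y' hy hy' => simp [hy, hy']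
    | single b w => simp only [single_eq_smul_e, map_smul, map_smulₛₗ, LinearMap.smul_apply, h]

theorem injective_of_hermitianForm_map_map
    {r : (((Fin 2 × Fin 2) × ℤ) →₀ ℂ) →ₗ[ℂ] (((Fin 2 × Fin 2) × ℤ) →₀ ℂ)}
    (h : ∀ x y, hermitianForm (r x) (r y) = hermitianForm x y) : Function.Injective r := by
  intro x y hxy
  ext a
  rw [← hermitianForm_e a x, ← hermitianForm_e a y, ← h _ x, ← h _ y, hxy]

theorem surjective_of_e_mem_range
    {r : (((Fin 2 × Fin 2) × ℤ) →₀ ℂ) →ₗ[ℂ] (((Fin 2 × Fin 2) × ℤ) →₀ ℂ)}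
    (h : ∀ a, e a ∈ LinearMap.range r) : Function.Surjective r := by
  intro y
  change y ∈ LinearMap.range r
  induction y using Finsupp.induction_linear with
  | zero => exact zero_mem _
  | add y y' hy hy' => exact add_mem hy hy'
  | single a v => exact single_eq_smul_e a v ▸ Submodule.smul_mem _ v (h a)

theorem conj_exp_mul_exp (β : ℝ) (l : ℤ) :
    (starRingEnd ℂ) (Complex.exp (Complex.I * (β : ℂ) * (l : ℂ) ^ 2)) *
      Complex.exp (Complex.I * (β : ℂ) * (l : ℂ) ^ 2) = 1 := by
  rw [← Complex.exp_conj, ← Complex.exp_add]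
  simp

theorem stmt_10 (θ β : ℝ)
    (s : ℝ) (c : ℝ) (hs : s = Real.sin θ) (hc : c = Real.cos θ)
    (r : (((Fin 2 × Fin 2) × ℤ) →₀ ℂ) →ₗ[ℂ] (((Fin 2 × Fin 2) × ℤ) →₀ ℂ))
    (hr00 : ∀ l : ℤ, r (e ((0, 0), l)) =
      Complex.exp (Complex.I * (β : ℂ) * (l : ℂ) ^ 2) • e ((0, 0), l))
    (hr01 : ∀ l : ℤ, r (e ((0, 1), l)) =
      Complex.exp (Complex.I * (β : ℂ) * (l : ℂ) ^ 2) •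
        ((-Complex.I * (s : ℂ)) • e ((0, 1), l) + (c : ℂ) • e ((1, 0), l + 1)))
    (hr10 : ∀ l : ℤ, r (e ((1, 0), l)) =
      Complex.exp (Complex.I * (β : ℂ) * (l : ℂ) ^ 2) •
        ((c : ℂ) • e ((0, 1), l - 1) + (-Complex.I * (s : ℂ)) • e ((1, 0), l)))
    (hr11 : ∀ l : ℤ, r (e ((1, 1), l)) =
      -Complex.exp (Complex.I * (β : ℂ) * (l : ℂ) ^ 2) • e ((1, 1), l)) :
    Function.Bijective r ∧
      ∀ x y : ((Fin 2 × Fin 2) × ℤ) →₀ ℂ,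
        ((r x).sum fun a v => (starRingEnd ℂ) v * (r y) a) =
          x.sum fun a v => (starRingEnd ℂ) v * y a := by
  have hsc : (s : ℂ) ^ 2 + (c : ℂ) ^ 2 = 1 := by
    rw [hs, hc]
    exact_mod_cast Real.sin_sq_add_cos_sq θ
  have hI : Complex.I ^ 2 = -1 := Complex.I_sq
  have hphase := conj_exp_mul_exp β
  generalize hp : (fun l : ℤ => Complex.exp (Complex.I * (β : ℂ) * (l : ℂ) ^ 2)) = p
  have hp' (l : ℤ) : Complex.exp (Complex.I * (β : ℂ) * (l : ℂ) ^ 2) = p l := congrFun hp l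
  simp only [hp'] at hr00 hr01 hr10 hr11 hphase
  have hbasis (a b) : hermitianForm (r (e a)) (r (e b)) = hermitianForm (e a) (e b) := by
    obtain ⟨⟨m, n⟩, l⟩ := a
    obtain ⟨⟨m', n'⟩, l'⟩ := b
    have hl := hphase l
    fin_cases m <;> fin_cases n <;> fin_cases m' <;> fin_cases n' <;>
      simp [hr00, hr01, hr10, hr11, hermitianForm_e, -Complex.coe_smul] <;>
      clear hr00 hr01 hr10 hr11 hp hp' <;> simp [e, Finsupp.single_apply, -Complex.coe_smul] <;>
      grind
  have hform := hermitianForm_map_map hbasis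
  refine ⟨⟨injective_of_hermitianForm_map_map hform, surjective_of_e_mem_range ?_⟩, hform⟩
  have h01 (l : ℤ) : e ((0, 1), l) ∈ LinearMap.range r := by
    refine ⟨(Complex.I * s * (starRingEnd ℂ) (p l)) • e ((0, 1), l) +
      (c * (starRingEnd ℂ) (p (l + 1))) • e ((1, 0), l + 1), ?_⟩
    simp only [map_add, map_smul, hr01, hr10, add_sub_cancel_right]
    match_scalars
    · linear_combination hsc - (s : ℂ) ^ 2 * hI * ((starRingEnd ℂ) (p l) * p l) +
        (s : ℂ) ^ 2 * hphase l + (c : ℂ) ^ 2 * hphase (l + 1)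
    · linear_combination Complex.I * s * c * hphase l - Complex.I * s * c * hphase (l + 1)
  have h10 (l : ℤ) : e ((1, 0), l) ∈ LinearMap.range r := by
    refine ⟨(c * (starRingEnd ℂ) (p (l - 1))) • e ((0, 1), l - 1) +
      (Complex.I * s * (starRingEnd ℂ) (p l)) • e ((1, 0), l), ?_⟩
    simp only [map_add, map_smul, hr01, hr10, sub_add_cancel]
    match_scalars
    · linear_combination Complex.I * s * c * hphase l - Complex.I * s * c * hphase (l - 1)
    · linear_combination hsc - (s : ℂ) ^ 2 * hI * ((starRingEnd ℂ) (p l) * p l) +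
        (s : ℂ) ^ 2 * hphase l + (c : ℂ) ^ 2 * hphase (l - 1)
  rintro ⟨⟨m, n⟩, l⟩
  fin_cases m <;> fin_cases n
  · exact ⟨(starRingEnd ℂ) (p l) • e ((0, 0), l), by simp [hr00, smul_smul, hphase]⟩
  · exact h01 l
  · exact h10 l
  · exact ⟨-(starRingEnd ℂ) (p l) • e ((1, 1), l), by simp [hr11, smul_smul, hphase]⟩
end
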